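/- arXiv:1011.0138 — 7 statements merged into one kernel-verified Lean document; each statement's English description precedes it below -/
import Mathlib

section
/- Let μ be a finite nonzero Borel measure on ℝ all of whose moments y_k = ∫ x^k dμ are finite, and suppose supp μ ⊆ [a,∞) for some a ∈ ℝ. If y_0 y_2 − y_1² > 0 and (y_0 y_3 − y_1 y_2)² ≥ 4 (y_0 y_2 − y_1²)(y_1 y_3 − y_2²), then a ≤ ( y_0 y_3 − y_1 y_2 − √( (y_0 y_3 − y_1 y_2)² − 4 (y_0 y_2 − y_1²)(y_1 y_3 − y_2²) ) ) / ( 2 (y_0 y_2 − y_1²) ). -/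
open MeasureTheory Filter

/-- The support of a measure: the smallest closed set whose complement is null. -/
noncomputable def msupport {α : Type*} [TopologicalSpace α] [MeasurableSpace α]
    (μ : Measure α) : Set α :=
  ⋂₀ {C : Set α | IsClosed C ∧ μ Cᶜ = 0}

/-- The localizing matrix `H_d(θ_a y)` associated with the moment sequence `y` and the
polynomial `θ_a(x) = x - a`: its `(i,j)` entry is `y_{i+j+1} - a y_{i+j}`. -/
noncomputable def locMat (y : ℕ → ℝ) (d : ℕ) (a : ℝ) :
    Matrix (Fin (d + 1)) (Fin (d + 1)) ℝ :=
  Matrix.of fun i j : Fin (d + 1) => y (i + j + 1 : ℕ) - a * y (i + j : ℕ)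

/-- The localizing matrix `H_d(-θ_b y)` associated with the moment sequence `y` and the
polynomial `-θ_b(x) = b - x`: its `(i,j)` entry is `b y_{i+j} - y_{i+j+1}`. -/
noncomputable def negLocMat (y : ℕ → ℝ) (d : ℕ) (b : ℝ) :
    Matrix (Fin (d + 1)) (Fin (d + 1)) ℝ :=
  Matrix.of fun i j : Fin (d + 1) => b * y (i + j : ℕ) - y (i + j + 1 : ℕ)

lemma ae_le_of_msupport_subset_Ici {μ : Measure ℝ} {a : ℝ} (h : msupport μ ⊆ Set.Ici a) :
    ∀ᵐ x ∂μ, a ≤ x := by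
  have hs : msupport μ = μ.support := Measure.support_eq_sInter.symm
  filter_upwards [Measure.support_mem_ae (μ := μ)] with x hx
  exact h (hs ▸ hx)

/-- Positivity of the localizing form of degree one of `x - a`. -/
lemma localizing_form_nonneg {μ : Measure ℝ} (hint : ∀ k : ℕ, Integrable (fun x => x ^ k) μ)
    {a : ℝ} (ha : ∀ᵐ x ∂μ, a ≤ x) {y : ℕ → ℝ} (hy : ∀ k, y k = ∫ x, x ^ k ∂μ) (p q : ℝ) :
    0 ≤ p ^ 2 * (y 1 - a * y 0) + 2 * p * q * (y 2 - a * y 1) + q ^ 2 * (y 3 - a * y 2) := by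
  have hnn : 0 ≤ ∫ x, (p + q * x) ^ 2 * (x - a) ∂μ := by
    refine integral_nonneg_of_ae ?_
    filter_upwards [ha] with x hx
    exact mul_nonneg (sq_nonneg _) (sub_nonneg.2 hx)
  have hexpand : ∀ x : ℝ, (p + q * x) ^ 2 * (x - a) =
      (-a * p ^ 2) * x ^ 0 + (p ^ 2 - 2 * a * p * q) * x ^ 1 +
        (2 * p * q - a * q ^ 2) * x ^ 2 + q ^ 2 * x ^ 3 := fun x => by ring
  have hi : ∀ (c : ℝ) (k : ℕ), Integrable (fun x => c * x ^ k) μ :=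
    fun c k => (hint k).const_mul c
  simp_rw [hexpand] at hnn
  rw [integral_add (by exact ((hi _ 0).add (hi _ 1)).add (hi _ 2)) (hi _ 3),
    integral_add (by exact (hi _ 0).add (hi _ 1)) (hi _ 2), integral_add (hi _ 0) (hi _ 1)] at hnn
  simp only [integral_const_mul, ← hy] at hnn
  linarith

/-- a quadratic-root upper bound on any `a` with `supp μ ⊆ [a, ∞)`. -/
theorem sqrt_upper_bound_on_a_of_support_subset_Ici
    (μ : Measure ℝ) [IsFiniteMeasure μ] (hμ : μ ≠ 0)
    (hint : ∀ k : ℕ, Integrable (fun x => x ^ k) μ)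
    (y : ℕ → ℝ) (hy : ∀ k, y k = ∫ x, x ^ k ∂μ) (a : ℝ)
    (hsupp : msupport μ ⊆ Set.Ici a)
    (h1 : 0 < y 0 * y 2 - y 1 ^ 2)
    (h2 : 4 * (y 0 * y 2 - y 1 ^ 2) * (y 1 * y 3 - y 2 ^ 2) ≤ (y 0 * y 3 - y 1 * y 2) ^ 2) :
    a ≤ (y 0 * y 3 - y 1 * y 2 -
        Real.sqrt ((y 0 * y 3 - y 1 * y 2) ^ 2 -
          4 * (y 0 * y 2 - y 1 ^ 2) * (y 1 * y 3 - y 2 ^ 2))) /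
      (2 * (y 0 * y 2 - y 1 ^ 2)) := by
  have hform := localizing_form_nonneg hint (ae_le_of_msupport_subset_Ici hsupp) hy
  have hy0 : 0 < y 0 := by
    have : NeZero μ := ⟨hμ⟩
    rw [hy 0]
    simp
  have hX : 0 ≤ y 1 - a * y 0 := by simpa using hform 1 0
  have hdet : discrim (y 1 - a * y 0) (2 * (y 2 - a * y 1)) (y 3 - a * y 2) ≤ 0 :=
    discrim_le_zero fun p => by linarith [hform p 1]
  rw [discrim] at hdet
  have hvertex : 0 ≤ y 0 * y 3 - y 1 * y 2 - 2 * (y 0 * y 2 - y 1 ^ 2) * a := by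
    refine nonneg_of_mul_nonneg_right (a := y 0) ?_ hy0
    linarith [hform (-y 1) (y 0), mul_nonneg h1.le hX]
  rw [le_div_iff₀ (by positivity)]
  have hsqrt : √((y 0 * y 3 - y 1 * y 2) ^ 2 -
      4 * (y 0 * y 2 - y 1 ^ 2) * (y 1 * y 3 - y 2 ^ 2)) ≤
      y 0 * y 3 - y 1 * y 2 - 2 * (y 0 * y 2 - y 1 ^ 2) * a :=
    Real.sqrt_le_iff.2 ⟨hvertex, by linarith [mul_nonneg h1.le (neg_nonneg.2 hdet)]⟩
  linarith
end

section
/- Let μ be a finite nonzero Borel measure on ℝ all of whose moments y_k = ∫ x^k dμ are finite, and suppose supp μ ⊆ (−∞,b] for some b ∈ ℝ. If y_0 y_2 − y_1² > 0 and (y_0 y_3 − y_1 y_2)² ≥ 4 (y_0 y_2 − y_1²)(y_1 y_3 − y_2²), then b ≥ ( y_0 y_3 − y_1 y_2 + √( (y_0 y_3 − y_1 y_2)² − 4 (y_0 y_2 − y_1²)(y_1 y_3 − y_2²) ) ) / ( 2 (y_0 y_2 − y_1²) ). -/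
open MeasureTheory Filter

theorem ae_le_of_msupport_subset_Iic {μ : Measure ℝ} {b : ℝ} (h : msupport μ ⊆ Set.Iic b) :
    ∀ᵐ x ∂μ, x ≤ b := by
  refine measure_null_of_locally_null _ fun x hx => ?_
  have hxs : x ∉ msupport μ := fun hm => hx (h hm)
  simp only [msupport, Set.mem_sInter, not_forall] at hxs
  obtain ⟨C, ⟨hC, hμC⟩, hxC⟩ := hxs
  exact ⟨Cᶜ, mem_nhdsWithin_of_mem_nhds (hC.isOpen_compl.mem_nhds hxC), hμC⟩

/-- The quadratic form of `negLocMat y 1 b` is nonnegative. -/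
theorem negLocMat_one_quadratic_nonneg {μ : Measure ℝ}
    (hint : ∀ k : ℕ, Integrable (fun x => x ^ k) μ) {b : ℝ} (hb : ∀ᵐ x ∂μ, x ≤ b)
    {y : ℕ → ℝ} (hy : ∀ k, y k = ∫ x, x ^ k ∂μ) (u v : ℝ) :
    0 ≤ (b * y 0 - y 1) * u ^ 2 + 2 * (b * y 1 - y 2) * (u * v) + (b * y 2 - y 3) * v ^ 2 := by
  have hpos : 0 ≤ ∫ x, (b - x) * (u + v * x) ^ 2 ∂μ := by
    refine integral_nonneg_of_ae ?_
    filter_upwards [hb] with x hx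
    exact mul_nonneg (sub_nonneg.2 hx) (sq_nonneg _)
  have hexp : (fun x : ℝ => (b - x) * (u + v * x) ^ 2) = fun x =>
      b * u ^ 2 * x ^ 0 + (2 * b * u * v - u ^ 2) * x ^ 1 +
        (b * v ^ 2 - 2 * u * v) * x ^ 2 + (-v ^ 2) * x ^ 3 := by
    ext x
    ring
  have hi (c : ℝ) (k : ℕ) : Integrable (fun x => c * x ^ k) μ := (hint k).const_mul c
  rw [hexp, integral_add (by fun_prop) (hi _ 3), integral_add (by fun_prop) (hi _ 2),
    integral_add (hi _ 0) (hi _ 1)] at hpos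
  simp only [integral_const_mul, ← hy] at hpos
  linarith

/-- a quadratic-root lower bound on any `b` with `supp μ ⊆ (-∞, b]`. -/
theorem sqrt_lower_bound_on_b_of_support_subset_Iic
    (μ : Measure ℝ) [IsFiniteMeasure μ] (hμ : μ ≠ 0)
    (hint : ∀ k : ℕ, Integrable (fun x => x ^ k) μ)
    (y : ℕ → ℝ) (hy : ∀ k, y k = ∫ x, x ^ k ∂μ) (b : ℝ)
    (hsupp : msupport μ ⊆ Set.Iic b)
    (h1 : 0 < y 0 * y 2 - y 1 ^ 2)
    (h2 : 4 * (y 0 * y 2 - y 1 ^ 2) * (y 1 * y 3 - y 2 ^ 2) ≤ (y 0 * y 3 - y 1 * y 2) ^ 2) :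
    (y 0 * y 3 - y 1 * y 2 +
        Real.sqrt ((y 0 * y 3 - y 1 * y 2) ^ 2 -
          4 * (y 0 * y 2 - y 1 ^ 2) * (y 1 * y 3 - y 2 ^ 2))) /
      (2 * (y 0 * y 2 - y 1 ^ 2)) ≤ b := by
  have hq := negLocMat_one_quadratic_nonneg hint (ae_le_of_msupport_subset_Iic hsupp) hy
  have hy0 : 0 < y 0 := by
    have h0 : 0 ≤ y 0 := by
      rw [hy]
      exact integral_nonneg fun x => by simp
    refine h0.lt_of_ne fun h => ?_
    rw [← h] at h1
    nlinarith [sq_nonneg (y 1)]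
  have hdet : (b * y 1 - y 2) ^ 2 ≤ (b * y 0 - y 1) * (b * y 2 - y 3) := by
    have hd := discrim_le_zero (a := b * y 2 - y 3) (b := 2 * (b * y 1 - y 2))
      (c := b * y 0 - y 1) fun t => by linarith [hq 1 t]
    unfold discrim at hd
    linarith
  have hα : 0 ≤ b * y 0 - y 1 := by linarith [hq 1 0]
  have hvertex : 0 ≤ 2 * (y 0 * y 2 - y 1 ^ 2) * b - (y 0 * y 3 - y 1 * y 2) := by
    refine nonneg_of_mul_nonneg_right ?_ hy0
    linarith [hq (y 1) (-y 0), mul_nonneg h1.le hα]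
  rw [div_le_iff₀ (by linarith)]
  have hsqrt : Real.sqrt ((y 0 * y 3 - y 1 * y 2) ^ 2 -
      4 * (y 0 * y 2 - y 1 ^ 2) * (y 1 * y 3 - y 2 ^ 2)) ≤
      2 * (y 0 * y 2 - y 1 ^ 2) * b - (y 0 * y 3 - y 1 * y 2) := by
    refine Real.sqrt_le_iff.2 ⟨hvertex, ?_⟩
    linarith [mul_nonneg h1.le (sub_nonneg.2 hdet)]
  linarith
end

section
/- Let μ be a finite nonzero Borel measure on ℝ all of whose moments y_k = ∫ x^k dμ are finite, and let d ∈ ℕ. Then the set A_d = { a ∈ ℝ : H_d(θ_a y) is positive semidefinite } is nonempty, closed, and bounded above by y_1/y_0, and its supremum a_d := sup A_d belongs to A_d (i.e., the semidefinite program max{ a : H_d(θ_a y) ⪰ 0 } has an optimal solution). -/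
open MeasureTheory Filter

open Matrix in
/-- The quadratic form of the Hankel matrix of the shifted moment sequence. -/
theorem hankel_dotProduct_eq_integral {μ : Measure ℝ}
    (hint : ∀ k : ℕ, Integrable (fun x => x ^ k) μ) {y : ℕ → ℝ} (hy : ∀ k, y k = ∫ x, x ^ k ∂μ)
    {n : ℕ} (k : ℕ) (v : Fin n → ℝ) :
    Integrable (fun x => x ^ k * (∑ i, v i * x ^ (i : ℕ)) ^ 2) μ ∧
    v ⬝ᵥ (Matrix.of fun i j : Fin n => y (i + j + k : ℕ)) *ᵥ v =
      ∫ x, x ^ k * (∑ i, v i * x ^ (i : ℕ)) ^ 2 ∂μ := by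
  have expand : (fun x : ℝ => x ^ k * (∑ i, v i * x ^ (i : ℕ)) ^ 2) =
      fun x => ∑ i, ∑ j, v i * v j * x ^ (i + j + k : ℕ) := by
    funext x
    rw [sq, Finset.sum_mul_sum, Finset.mul_sum]
    refine Finset.sum_congr rfl fun i _ => ?_
    rw [Finset.mul_sum]
    exact Finset.sum_congr rfl fun j _ => by ring
  rw [expand]
  have term (i j : Fin n) : Integrable (fun x => v i * v j * x ^ (i + j + k : ℕ)) μ :=
    (hint _).const_mul _
  refine ⟨integrable_finsetSum _ fun i _ => integrable_finsetSum _ fun j _ => term i j, ?_⟩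
  rw [integral_finsetSum _ fun i _ => integrable_finsetSum _ fun j _ => term i j]
  simp only [dotProduct, mulVec, of_apply]
  refine Finset.sum_congr rfl fun i _ => ?_
  rw [integral_finsetSum _ fun j _ => term i j, Finset.mul_sum]
  refine Finset.sum_congr rfl fun j _ => ?_
  rw [integral_const_mul, hy]
  ring

open Matrix in
/-- If `B` is positive definite as a quadratic form, then `A - a • B` is nonnegative for some `a`. -/
theorem exists_mul_dotProduct_le {ι : Type*} [Fintype ι] [Nonempty ι] (A B : Matrix ι ι ℝ)
    (hB : ∀ v, v ≠ 0 → 0 < v ⬝ᵥ B *ᵥ v) :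
    ∃ a : ℝ, ∀ v, a * (v ⬝ᵥ B *ᵥ v) ≤ v ⬝ᵥ A *ᵥ v := by
  have cont (M : Matrix ι ι ℝ) : Continuous fun v : ι → ℝ => v ⬝ᵥ M *ᵥ v := by
    simp only [dotProduct, mulVec]
    fun_prop
  have scale (M : Matrix ι ι ℝ) (c : ℝ) (v : ι → ℝ) :
      (c • v) ⬝ᵥ M *ᵥ (c • v) = c ^ 2 * (v ⬝ᵥ M *ᵥ v) := by
    simp only [mulVec_smul, smul_dotProduct, dotProduct_smul, smul_eq_mul]
    ring
  have ne_zero {v : ι → ℝ} (hv : v ∈ Metric.sphere (0 : ι → ℝ) 1) : v ≠ 0 :=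
    ne_zero_of_mem_unit_sphere ⟨v, hv⟩
  obtain ⟨w, -, hw⟩ := (isCompact_sphere (0 : ι → ℝ) 1).exists_isMinOn
    (NormedSpace.sphere_nonempty.2 zero_le_one)
    ((cont A).continuousOn.div (cont B).continuousOn fun v hv => (hB v (ne_zero hv)).ne')
  refine ⟨(w ⬝ᵥ A *ᵥ w) / (w ⬝ᵥ B *ᵥ w), fun v => ?_⟩
  rcases eq_or_ne v 0 with rfl | hv
  · simp
  have unit : ‖v‖⁻¹ • v ∈ Metric.sphere (0 : ι → ℝ) 1 := by
    simp [norm_smul, norm_ne_zero_iff.2 hv]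
  have key : (w ⬝ᵥ A *ᵥ w) / (w ⬝ᵥ B *ᵥ w) * _ ≤ _ :=
    (le_div_iff₀ (hB _ (ne_zero unit))).1 (hw unit)
  beta_reduce at key
  rw [scale, scale, mul_left_comm] at key
  exact le_of_mul_le_mul_left key (by positivity)

/-- A measure for which a nonzero polynomial vanishes almost everywhere is bounded below. -/
theorem exists_ae_ge_of_ae_sum_eq_zero {μ : Measure ℝ} {n : ℕ} {v : Fin n → ℝ} (hv : v ≠ 0)
    (h : ∀ᵐ x ∂μ, ∑ i, v i * x ^ (i : ℕ) = 0) : ∃ m : ℝ, ∀ᵐ x ∂μ, m ≤ x := by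
  set p : Polynomial ℝ := ∑ i : Fin n, Polynomial.monomial (i : ℕ) (v i) with hp
  have p_ne : p ≠ 0 := by
    obtain ⟨i, hi⟩ := Function.ne_iff.1 hv
    intro h0
    apply hi
    have := congrArg (fun q => Polynomial.coeff q (i : ℕ)) h0
    simpa [hp, Polynomial.finsetSum_coeff, Polynomial.coeff_monomial, Fin.val_inj] using this
  obtain ⟨m, hm⟩ := p.roots.toFinset.bddBelow
  refine ⟨m, h.mono fun x hx => hm ?_⟩
  have root : p.IsRoot x := by
    simpa [hp, Polynomial.IsRoot, Polynomial.eval_finsetSum] using hx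
  simpa [p_ne] using root

open Matrix in
theorem locMat_dotProduct (y : ℕ → ℝ) (d : ℕ) (a : ℝ) (v : Fin (d + 1) → ℝ) :
    v ⬝ᵥ locMat y d a *ᵥ v =
      v ⬝ᵥ (Matrix.of fun i j : Fin (d + 1) => y (i + j + 1 : ℕ)) *ᵥ v -
        a * (v ⬝ᵥ (Matrix.of fun i j : Fin (d + 1) => y (i + j + 0 : ℕ)) *ᵥ v) := by
  have : locMat y d a = (Matrix.of fun i j : Fin (d + 1) => y (i + j + 1 : ℕ)) -
      a • (Matrix.of fun i j : Fin (d + 1) => y (i + j + 0 : ℕ)) := by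
    ext i j
    simp [locMat]
  rw [this, sub_mulVec, dotProduct_sub, smul_mulVec, dotProduct_smul, smul_eq_mul]

open Matrix in
theorem locMat_posSemidef_iff (y : ℕ → ℝ) (d : ℕ) (a : ℝ) :
    (locMat y d a).PosSemidef ↔ ∀ v, 0 ≤ v ⬝ᵥ locMat y d a *ᵥ v := by
  have herm : (locMat y d a).IsHermitian := by
    ext i j
    simp [locMat, add_comm (i : ℕ)]
  simp only [posSemidef_iff_dotProduct_mulVec, herm, true_and, star_trivial]

theorem isClosed_setOf_locMat_posSemidef (y : ℕ → ℝ) (d : ℕ) :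
    IsClosed {a : ℝ | (locMat y d a).PosSemidef} := by
  simp only [locMat_posSemidef_iff, locMat_dotProduct, Set.ofPred_forall]
  exact isClosed_iInter fun v => isClosed_le (by fun_prop) (by fun_prop)

open Matrix in
theorem exists_locMat_posSemidef {μ : Measure ℝ}
    (hint : ∀ k : ℕ, Integrable (fun x => x ^ k) μ) {y : ℕ → ℝ} (hy : ∀ k, y k = ∫ x, x ^ k ∂μ)
    (d : ℕ) : ∃ a, (locMat y d a).PosSemidef := by
  simp only [locMat_posSemidef_iff, locMat_dotProduct, sub_nonneg]
  by_cases hpos : ∀ v : Fin (d + 1) → ℝ, v ≠ 0 →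
      0 < v ⬝ᵥ (Matrix.of fun i j : Fin (d + 1) => y (i + j + 0 : ℕ)) *ᵥ v
  · exact exists_mul_dotProduct_le _ _ hpos
  push Not at hpos
  obtain ⟨v, hv, hle⟩ := hpos
  obtain ⟨hi, he⟩ := hankel_dotProduct_eq_integral hint hy 0 v
  rw [he] at hle
  simp only [pow_zero, one_mul] at hle hi
  have hae := (integral_eq_zero_iff_of_nonneg (fun x => sq_nonneg _) hi).1
    (hle.antisymm (integral_nonneg fun x => sq_nonneg _))
  obtain ⟨m, hm⟩ := exists_ae_ge_of_ae_sum_eq_zero hv (hae.mono fun x hx => by simpa using hx)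
  refine ⟨m, fun w => ?_⟩
  obtain ⟨hi₀, he₀⟩ := hankel_dotProduct_eq_integral hint hy 0 w
  obtain ⟨hi₁, he₁⟩ := hankel_dotProduct_eq_integral hint hy 1 w
  rw [he₀, he₁, ← integral_const_mul]
  refine integral_mono_ae (hi₀.const_mul m) hi₁ (hm.mono fun x hx => ?_)
  simpa using mul_le_mul_of_nonneg_right hx (sq_nonneg _)

/-- the feasible set `A_d = {a : H_d(θ_a y) ⪰ 0}` of the semidefinite program
(3.8) is nonempty, closed, bounded above by `y₁/y₀`, and its supremum is attained. -/
theorem sdp_a_has_optimal_solution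
    (μ : Measure ℝ) [IsFiniteMeasure μ] (hμ : μ ≠ 0)
    (hint : ∀ k : ℕ, Integrable (fun x => x ^ k) μ)
    (y : ℕ → ℝ) (hy : ∀ k, y k = ∫ x, x ^ k ∂μ) (d : ℕ) :
    {a : ℝ | (locMat y d a).PosSemidef}.Nonempty ∧
    IsClosed {a : ℝ | (locMat y d a).PosSemidef} ∧
    (∀ a ∈ {a : ℝ | (locMat y d a).PosSemidef}, a ≤ y 1 / y 0) ∧
    sSup {a : ℝ | (locMat y d a).PosSemidef} ∈ {a : ℝ | (locMat y d a).PosSemidef} := by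
  have hne : {a : ℝ | (locMat y d a).PosSemidef}.Nonempty := exists_locMat_posSemidef hint hy d
  have hcl := isClosed_setOf_locMat_posSemidef y d
  have hub : ∀ a ∈ {a : ℝ | (locMat y d a).PosSemidef}, a ≤ y 1 / y 0 := by
    intro a ha
    have hy0 : 0 < y 0 := by
      rw [hy]
      simp [measureReal_def, ENNReal.toReal_pos_iff, pos_iff_ne_zero, hμ, measure_lt_top]
    rw [le_div_iff₀ hy0]
    simpa [locMat] using ha.diag_nonneg (i := 0)
  exact ⟨hne, hcl, hub, hcl.csSup_mem hne ⟨_, hub⟩⟩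
end

section
/- Let μ be a finite nonzero Borel measure on ℝ all of whose moments y_k = ∫ x^k dμ are finite, and let d ∈ ℕ. Then the set B_d = { b ∈ ℝ : H_d(−θ_b y) is positive semidefinite } is nonempty, closed, and bounded below by y_1/y_0, and its infimum b_d := inf B_d belongs to B_d (i.e., the semidefinite program min{ b : H_d(−θ_b y) ⪰ 0 } has an optimal solution). -/
open MeasureTheory Filter

open scoped Matrix InnerProductSpace

/-- If `ker T ≤ ker S` and the domain of `T` is finite-dimensional, then `S` is bounded relative
to `T`. -/
theorem LinearMap.exists_norm_le_mul_norm_of_ker_le {V E F : Type*} [AddCommGroup V] [Module ℝ V]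
    [FiniteDimensional ℝ V] [NormedAddCommGroup E] [NormedSpace ℝ E]
    [NormedAddCommGroup F] [NormedSpace ℝ F] (T : V →ₗ[ℝ] E) (S : V →ₗ[ℝ] F)
    (h : LinearMap.ker T ≤ LinearMap.ker S) : ∃ C : ℝ, ∀ v, ‖S v‖ ≤ C * ‖T v‖ := by
  obtain ⟨R, hR⟩ := T.rangeRestrict.exists_rightInverse_of_surjective T.range_rangeRestrict
  refine ⟨‖LinearMap.toContinuousLinearMap (S ∘ₗ R)‖, fun v => ?_⟩
  have hker : v - R (T.rangeRestrict v) ∈ LinearMap.ker T := by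
    have hT := congrArg Subtype.val (LinearMap.congr_fun hR (T.rangeRestrict v))
    simp only [LinearMap.comp_apply, LinearMap.id_apply, LinearMap.codRestrict_apply,
      LinearMap.rangeRestrict] at hT
    rw [LinearMap.mem_ker, map_sub, sub_eq_zero]
    exact hT.symm
  have hS : S v = (S ∘ₗ R) (T.rangeRestrict v) := by
    have := h hker
    rwa [LinearMap.mem_ker, map_sub, sub_eq_zero] at this
  rw [hS]
  exact (LinearMap.toContinuousLinearMap (S ∘ₗ R)).le_opNorm (T.rangeRestrict v)

theorem negLocMat_isHermitian (y : ℕ → ℝ) (d : ℕ) (b : ℝ) : (negLocMat y d b).IsHermitian := by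
  ext i j
  simp [negLocMat, add_comm (j : ℕ) i]

theorem isClosed_setOf_posSemidef_negLocMat (y : ℕ → ℝ) (d : ℕ) :
    IsClosed {b : ℝ | (negLocMat y d b).PosSemidef} := by
  simp only [Matrix.posSemidef_iff_dotProduct_mulVec, negLocMat_isHermitian, true_and,
    Set.ofPred_forall]
  refine isClosed_iInter fun v => isClosed_le continuous_const ?_
  simp only [dotProduct, Matrix.mulVec, negLocMat, Matrix.of_apply]
  fun_prop

/-- A sequence of Gram numbers `⟪e i, e j⟫ = y (i + j)` admits a feasible `b`. -/
theorem exists_posSemidef_negLocMat_of_inner_eq {E : Type*} [NormedAddCommGroup E]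
    [InnerProductSpace ℝ E] (e : ℕ → E) (y : ℕ → ℝ) (he : ∀ i j, ⟪e i, e j⟫_ℝ = y (i + j))
    (d : ℕ) : ∃ b, (negLocMat y d b).PosSemidef := by
  let T (k : ℕ) : (Fin (d + 1) → ℝ) →ₗ[ℝ] E :=
    Fintype.linearCombination ℝ fun i : Fin (d + 1) => e (i + k)
  have inner_T (k l : ℕ) (v : Fin (d + 1) → ℝ) :
      ⟪T k v, T l v⟫_ℝ = ∑ i, ∑ j, v i * v j * y (i + j + (k + l)) := by
    simp only [T, Fintype.linearCombination_apply, sum_inner, inner_sum, real_inner_smul_left,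
      real_inner_smul_right, he]
    refine Finset.sum_congr rfl fun i _ => Finset.sum_congr rfl fun j _ => ?_
    rw [show (j + k + (i + l) : ℕ) = i + j + (k + l) by ring]
    ring
  have hker : LinearMap.ker (T 0) ≤ LinearMap.ker (T 1) := fun v hv => by
    rw [LinearMap.mem_ker] at hv ⊢
    rw [← inner_self_eq_zero (𝕜 := ℝ), inner_T, ← inner_T 0 2, hv, inner_zero_left]
  obtain ⟨C, hC⟩ := (T 0).exists_norm_le_mul_norm_of_ker_le (T 1) hker
  refine ⟨C, .of_dotProduct_mulVec_nonneg (negLocMat_isHermitian y d C) fun v => ?_⟩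
  have hform : star v ⬝ᵥ (negLocMat y d C *ᵥ v) = C * ⟪T 0 v, T 0 v⟫_ℝ - ⟪T 0 v, T 1 v⟫_ℝ := by
    simp only [inner_T, dotProduct, Matrix.mulVec, negLocMat, Matrix.of_apply, Finset.mul_sum,
      ← Finset.sum_sub_distrib, star_trivial]
    refine Finset.sum_congr rfl fun i _ => Finset.sum_congr rfl fun j _ => ?_
    simp only [add_zero, zero_add]
    ring
  rw [hform, real_inner_self_eq_norm_mul_norm, sub_nonneg]
  calc ⟪T 0 v, T 1 v⟫_ℝ ≤ ‖T 0 v‖ * ‖T 1 v‖ := real_inner_le_norm _ _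
    _ ≤ ‖T 0 v‖ * (C * ‖T 0 v‖) := by gcongr; exact hC v
    _ = C * (‖T 0 v‖ * ‖T 0 v‖) := by ring

theorem memLp_two_pow_of_integrable_pow {μ : Measure ℝ}
    (hint : ∀ k : ℕ, Integrable (fun x => x ^ k) μ) (k : ℕ) :
    MemLp (fun x : ℝ => x ^ k) 2 μ := by
  rw [memLp_two_iff_integrable_sq (hint k).aestronglyMeasurable]
  simpa only [← pow_mul] using hint (k * 2)

theorem inner_toLp_pow {μ : Measure ℝ} (hint : ∀ k : ℕ, Integrable (fun x => x ^ k) μ)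
    (i j : ℕ) :
    ⟪(memLp_two_pow_of_integrable_pow hint i).toLp, (memLp_two_pow_of_integrable_pow hint j).toLp⟫_ℝ
      = ∫ x, x ^ (i + j) ∂μ := by
  rw [L2.inner_def]
  refine integral_congr_ae ?_
  filter_upwards [(memLp_two_pow_of_integrable_pow hint i).coeFn_toLp,
    (memLp_two_pow_of_integrable_pow hint j).coeFn_toLp] with x hi hj
  rw [hi, hj, Real.inner_apply, pow_add]

/-- the feasible set `B_d = {b : H_d(-θ_b y) ⪰ 0}` of the semidefinite program
(3.9) is nonempty, closed, bounded below by `y₁/y₀`, and its infimum is attained. -/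
theorem sdp_b_has_optimal_solution
    (μ : Measure ℝ) [IsFiniteMeasure μ] (hμ : μ ≠ 0)
    (hint : ∀ k : ℕ, Integrable (fun x => x ^ k) μ)
    (y : ℕ → ℝ) (hy : ∀ k, y k = ∫ x, x ^ k ∂μ) (d : ℕ) :
    {b : ℝ | (negLocMat y d b).PosSemidef}.Nonempty ∧
    IsClosed {b : ℝ | (negLocMat y d b).PosSemidef} ∧
    (∀ b ∈ {b : ℝ | (negLocMat y d b).PosSemidef}, y 1 / y 0 ≤ b) ∧
    sInf {b : ℝ | (negLocMat y d b).PosSemidef} ∈ {b : ℝ | (negLocMat y d b).PosSemidef} := by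
  have hy0 : 0 < y 0 := by
    have : NeZero μ := ⟨hμ⟩
    simp [hy]
  have hne : {b : ℝ | (negLocMat y d b).PosSemidef}.Nonempty :=
    exists_posSemidef_negLocMat_of_inner_eq _ y
      (fun i j => (inner_toLp_pow hint i j).trans (hy (i + j)).symm) d
  have hlb : ∀ b ∈ {b : ℝ | (negLocMat y d b).PosSemidef}, y 1 / y 0 ≤ b := fun b hb => by
    have h := Matrix.PosSemidef.diag_nonneg hb (i := 0)
    simp only [negLocMat, Matrix.of_apply, Fin.val_zero, add_zero, zero_add, sub_nonneg] at h
    exact (div_le_iff₀ hy0).2 h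
  have hcl := isClosed_setOf_posSemidef_negLocMat y d
  exact ⟨hne, hcl, hlb, hcl.csInf_mem hne ⟨_, hlb⟩⟩
end

section
/- Let μ be a finite nonzero Borel measure on ℝ with compact support, and let y_k = ∫ x^k dμ. For each d ∈ ℕ, the optimization problem ρ_d = min{ b − a : H_d(θ_a y) ⪰ 0 and H_d(−θ_b y) ⪰ 0 } has an optimal solution (a_d, b_d); as d → ∞, (a_d, b_d) → (a*, b*) where [a*, b*] is the smallest closed interval containing supp μ (i.e., a* = inf(supp μ), b* = sup(supp μ)); and if supp μ is an interval then supp μ = [a*, b*]. -/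
open MeasureTheory Filter

open Polynomial in
/-- The reals `t` for which `∫ (f - t) p ^ 2 ∂μ ≥ 0` for every real polynomial `p` of degree at
most `d`. -/
def sosLowerBounds (μ : Measure ℝ) (f : ℝ → ℝ) (d : ℕ) : Set ℝ :=
  {t | ∀ p : ℝ[X], p.natDegree ≤ d → 0 ≤ ∫ x, (f x - t) * p.eval x ^ 2 ∂μ}

section SosLowerBounds

open Polynomial

variable {μ : Measure ℝ}

lemma mem_sosLowerBounds_of_forall_le {f : ℝ → ℝ} {t : ℝ} (h : ∀ x ∈ μ.support, t ≤ f x)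
    (d : ℕ) : t ∈ sosLowerBounds μ f d := fun p _ => by
  refine integral_nonneg_of_ae ?_
  filter_upwards [Measure.support_mem_ae (μ := μ)] with x hx
  exact mul_nonneg (sub_nonneg.2 (h x hx)) (sq_nonneg _)

variable [IsFiniteMeasure μ]

lemma integrable_of_continuous_of_isCompact_support (hμ : IsCompact μ.support)
    {f : ℝ → ℝ} (hf : Continuous f) : Integrable f μ := by
  rw [← Measure.restrict_eq_self_of_ae_mem (Measure.support_mem_ae (μ := μ))]
  exact hf.continuousOn.integrableOn_compact hμ

/-- If a continuous function has nonnegative integral against all squares of polynomials, then it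
is nonnegative on the support of the measure. -/
lemma nonneg_on_support_of_forall_integral_mul_sq_nonneg (hμ : IsCompact μ.support)
    {g : ℝ → ℝ} (hg : Continuous g) (h : ∀ p : ℝ[X], 0 ≤ ∫ x, g x * p.eval x ^ 2 ∂μ) :
    ∀ x ∈ μ.support, 0 ≤ g x := by
  have hneg : Continuous fun x => max (-g x) 0 := by fun_prop
  obtain ⟨C, hC⟩ := hμ.exists_bound_of_continuousOn hg.continuousOn
  obtain ⟨a, ha⟩ := hμ.bddBelow
  obtain ⟨b, hb⟩ := hμ.bddAbove
  have hcube : ∫ x, max (-g x) 0 ^ 3 ∂μ ≤ 0 := by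
    have hlim : Tendsto (fun ε : ℝ => C * (ε * (2 * C + ε)) * μ.real Set.univ)
        (nhdsWithin 0 (Set.Ioi 0)) (nhds 0) := by
      have : Continuous fun ε : ℝ => C * (ε * (2 * C + ε)) * μ.real Set.univ := by fun_prop
      simpa using (this.tendsto 0).mono_left nhdsWithin_le_nhds
    refine ge_of_tendsto hlim ?_
    filter_upwards [self_mem_nhdsWithin] with ε (hε : 0 < ε)
    obtain ⟨p, hp⟩ := exists_polynomial_near_of_continuousOn a b _ hneg.continuousOn ε hε
    have hle : ∫ x, g x * p.eval x ^ 2 ∂μ ≤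
        ∫ x, (C * (ε * (2 * C + ε)) - max (-g x) 0 ^ 3) ∂μ := by
      refine integral_mono_ae
        (integrable_of_continuous_of_isCompact_support hμ (by fun_prop))
        (integrable_of_continuous_of_isCompact_support hμ (by fun_prop)) ?_
      filter_upwards [Measure.support_mem_ae (μ := μ)] with x hx
      have hpx := hp x ⟨ha hx, hb hx⟩
      have hgx : |g x| ≤ C := hC x hx
      have hC0 : 0 ≤ C := (abs_nonneg _).trans hgx
      set m := max (-g x) 0 with hm
      have hm0 : 0 ≤ m := le_max_right _ _
      have hmC : m ≤ C := max_le ((neg_le_abs _).trans hgx) hC0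
      have hgm : g x * m ^ 2 = -m ^ 3 := by
        rcases le_total (-g x) 0 with h' | h'
        · rw [hm, max_eq_right h']; simp
        · rw [hm, max_eq_left h']; ring
      have hsum : |p.eval x + m| ≤ 2 * C + ε := by
        calc |p.eval x + m| = |(p.eval x - m) + 2 * m| := by ring_nf
          _ ≤ |p.eval x - m| + |2 * m| := abs_add_le _ _
          _ ≤ 2 * C + ε := by rw [abs_of_nonneg (by positivity : 0 ≤ 2 * m)]; linarith
      have hbound : g x * ((p.eval x - m) * (p.eval x + m)) ≤ C * (ε * (2 * C + ε)) := by
        refine (le_abs_self _).trans ?_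
        rw [abs_mul, abs_mul]
        gcongr
      linear_combination hbound + hgm
    rw [integral_sub (integrable_const _)
      (integrable_of_continuous_of_isCompact_support hμ (by fun_prop)), integral_const,
      smul_eq_mul] at hle
    linarith [h p]
  have hae : (fun x => max (-g x) 0 ^ 3) =ᵐ[μ] 0 := by
    rw [← integral_eq_zero_iff_of_nonneg (fun x => by positivity)
      (integrable_of_continuous_of_isCompact_support hμ (by fun_prop))]
    exact le_antisymm hcube (integral_nonneg fun x => by positivity)
  refine Measure.support_subset_of_isClosed (isClosed_le continuous_const hg) ?_
  filter_upwards [hae] with x hx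
  have : max (-g x) 0 = 0 := by simpa using hx
  exact neg_nonpos.1 (max_eq_right_iff.1 this)

lemma integral_sub_mul_sq (hμ : IsCompact μ.support) {f : ℝ → ℝ} (hf : Continuous f) (t : ℝ)
    (p : ℝ[X]) :
    ∫ x, (f x - t) * p.eval x ^ 2 ∂μ = ∫ x, f x * p.eval x ^ 2 ∂μ - t * ∫ x, p.eval x ^ 2 ∂μ := by
  simp_rw [sub_mul]
  rw [integral_sub (integrable_of_continuous_of_isCompact_support hμ (by fun_prop))
    (integrable_of_continuous_of_isCompact_support hμ (by fun_prop)), integral_const_mul]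

/-- The supremum of `sosLowerBounds` is attained. -/
lemma exists_isGreatest_sosLowerBounds (hμ : IsCompact μ.support) (hμ0 : μ ≠ 0) {f : ℝ → ℝ}
    (hf : Continuous f) (d : ℕ) : ∃ t, IsGreatest (sosLowerBounds μ f d) t := by
  obtain ⟨m, -, hm⟩ := hμ.exists_isMinOn (Measure.nonempty_support hμ0) hf.continuousOn
  have hne : (sosLowerBounds μ f d).Nonempty := ⟨f m, mem_sosLowerBounds_of_forall_le hm d⟩
  have hbdd : BddAbove (sosLowerBounds μ f d) := by
    refine ⟨(∫ x, f x ∂μ) / μ.real Set.univ, fun t ht => ?_⟩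
    have h1 := ht 1 (by simp)
    rw [integral_sub_mul_sq hμ hf] at h1
    have hpos : 0 < μ.real Set.univ := by
      rw [measureReal_def]
      exact ENNReal.toReal_pos (by simpa using hμ0) (measure_ne_top _ _)
    rw [le_div_iff₀ hpos]
    simpa using h1
  have hclosed : IsClosed (sosLowerBounds μ f d) := by
    simp only [sosLowerBounds, Set.ofPred_forall, integral_sub_mul_sq hμ hf]
    exact isClosed_iInter fun p => isClosed_iInter fun _ =>
      isClosed_le continuous_const (by fun_prop)
  exact ⟨_, hclosed.csSup_mem hne hbdd, fun t ht => le_csSup hbdd ht⟩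

/-- The best sum-of-squares lower bounds converge to the minimum of `f` on the support. -/
lemma tendsto_of_isGreatest_sosLowerBounds (hμ : IsCompact μ.support) {f : ℝ → ℝ}
    (hf : Continuous f) {u : ℕ → ℝ} (hu : ∀ d, IsGreatest (sosLowerBounds μ f d) (u d)) {m : ℝ}
    (hm : IsLeast (f '' μ.support) m) : Tendsto u atTop (nhds m) := by
  have hmu : ∀ d, m ≤ u d := fun d =>
    (hu d).2 (mem_sosLowerBounds_of_forall_le (fun x hx => hm.2 ⟨x, hx, rfl⟩) d)
  refine tendsto_order.2 ⟨fun t ht => .of_forall fun d => ht.trans_le (hmu d), fun t ht => ?_⟩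
  obtain ⟨⟨x, hx, rfl⟩, -⟩ := hm
  obtain ⟨p, hp⟩ : ∃ p : ℝ[X], ∫ x, (f x - t) * p.eval x ^ 2 ∂μ < 0 := by
    by_contra! hcon
    have := nonneg_on_support_of_forall_integral_mul_sq_nonneg hμ (g := fun x => f x - t)
      (by fun_prop) hcon x hx
    linarith
  filter_upwards [eventually_ge_atTop p.natDegree] with d hd
  by_contra! htu
  have h1 := (hu d).1 p hd
  rw [integral_sub_mul_sq hμ hf] at h1 hp
  have h2 : t * ∫ x, p.eval x ^ 2 ∂μ ≤ u d * ∫ x, p.eval x ^ 2 ∂μ :=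
    mul_le_mul_of_nonneg_right htu (integral_nonneg fun x => sq_nonneg _)
  linarith

end SosLowerBounds

open Polynomial in
/-- A real Hankel-type matrix of weighted moments is positive semidefinite iff the weight has
nonnegative integral against the square of every polynomial of bounded degree. -/
lemma posSemidef_weightedMoments_iff {μ : Measure ℝ} [IsFiniteMeasure μ]
    (hμ : IsCompact μ.support) {g : ℝ → ℝ} (hg : Continuous g) {d : ℕ} :
    (Matrix.of fun i j : Fin (d + 1) => ∫ x, g x * x ^ (i + j : ℕ) ∂μ).PosSemidef ↔
      ∀ p : ℝ[X], p.natDegree ≤ d → 0 ≤ ∫ x, g x * p.eval x ^ 2 ∂μ := by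
  have hform : ∀ v : Fin (d + 1) → ℝ,
      star v ⬝ᵥ ((Matrix.of fun i j : Fin (d + 1) => ∫ x, g x * x ^ (i + j : ℕ) ∂μ).mulVec v) =
        ∫ x, g x * (∑ i, v i * x ^ (i : ℕ)) ^ 2 ∂μ := by
    intro v
    have hexp : ∀ x : ℝ, g x * (∑ i, v i * x ^ (i : ℕ)) ^ 2 =
        ∑ i, ∑ j : Fin (d + 1), v i * (g x * x ^ (i + j : ℕ) * v j) := by
      intro x
      rw [sq, Finset.sum_mul_sum, Finset.mul_sum]
      refine Finset.sum_congr rfl fun i _ => ?_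
      rw [Finset.mul_sum]
      exact Finset.sum_congr rfl fun j _ => by ring
    simp_rw [hexp]
    rw [integral_finsetSum _ fun i _ =>
      integrable_of_continuous_of_isCompact_support hμ (by fun_prop)]
    simp only [dotProduct, Matrix.mulVec, Pi.star_apply, star_trivial, Matrix.of_apply]
    refine Finset.sum_congr rfl fun i _ => ?_
    rw [integral_finsetSum _ fun j _ =>
      integrable_of_continuous_of_isCompact_support hμ (by fun_prop), Finset.mul_sum]
    exact Finset.sum_congr rfl fun j _ => by rw [integral_const_mul, integral_mul_const]
  rw [Matrix.posSemidef_iff_dotProduct_mulVec]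
  constructor
  · rintro ⟨-, h⟩ p hp
    have := h fun i => p.coeff i
    rw [hform] at this
    simpa only [eval_eq_sum_range' (Nat.lt_succ_of_le hp),
      ← Fin.sum_univ_eq_sum_range (fun i => p.coeff i * _ ^ i)] using this
  · refine fun h => ⟨Matrix.IsHermitian.ext fun i j => ?_, fun v => ?_⟩
    · simp [add_comm]
    · rw [hform]
      have hdeg : (∑ i, C (v i) * X ^ (i : ℕ) : ℝ[X]).natDegree ≤ d :=
        natDegree_sum_le_of_forall_le _ _ fun i _ =>
          (natDegree_C_mul_X_pow_le _ _).trans (Nat.lt_succ_iff.1 i.2)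
      simpa [eval_finsetSum] using h _ hdeg

lemma locMat_posSemidef_iff_s13 {μ : Measure ℝ} [IsFiniteMeasure μ] (hμ : IsCompact μ.support)
    {y : ℕ → ℝ} (hy : ∀ k, y k = ∫ x, x ^ k ∂μ) {d : ℕ} {a : ℝ} :
    (locMat y d a).PosSemidef ↔ a ∈ sosLowerBounds μ id d := by
  have : locMat y d a =
      Matrix.of fun i j : Fin (d + 1) => ∫ x, (id x - a) * x ^ (i + j : ℕ) ∂μ := by
    ext i j
    simp only [locMat, Matrix.of_apply, hy, id, sub_mul, ← pow_succ']
    rw [integral_sub (integrable_of_continuous_of_isCompact_support hμ (by fun_prop))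
      (integrable_of_continuous_of_isCompact_support hμ (by fun_prop)), integral_const_mul]
  rw [this]
  exact posSemidef_weightedMoments_iff hμ (g := fun x => id x - a) (by fun_prop)

lemma negLocMat_posSemidef_iff {μ : Measure ℝ} [IsFiniteMeasure μ] (hμ : IsCompact μ.support)
    {y : ℕ → ℝ} (hy : ∀ k, y k = ∫ x, x ^ k ∂μ) {d : ℕ} {b : ℝ} :
    (negLocMat y d b).PosSemidef ↔ -b ∈ sosLowerBounds μ (fun x => -x) d := by
  have : negLocMat y d b =
      Matrix.of fun i j : Fin (d + 1) => ∫ x, (-x - -b) * x ^ (i + j : ℕ) ∂μ := by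
    ext i j
    simp only [negLocMat, Matrix.of_apply, hy, neg_sub_neg, sub_mul, ← pow_succ']
    rw [integral_sub (integrable_of_continuous_of_isCompact_support hμ (by fun_prop))
      (integrable_of_continuous_of_isCompact_support hμ (by fun_prop)), integral_const_mul]
  rw [this]
  exact posSemidef_weightedMoments_iff hμ (g := fun x => -x - -b) (by fun_prop)

lemma msupport_eq_support {α : Type*} [TopologicalSpace α] [MeasurableSpace α] (μ : Measure α) :
    msupport μ = μ.support :=
  Measure.support_eq_sInter.symm

/-- for a compactly supported `μ`, the joint SDP `min { b - a : H_d(θ_a y) ⪰ 0,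
H_d(-θ_b y) ⪰ 0 }` has an optimal solution `(a_d, b_d)` for each `d`; any sequence of optimal
solutions converges to `(a*, b*)` with `a* = inf (supp μ)`, `b* = sup (supp μ)`; `[a*, b*]` is
the smallest interval containing `supp μ`; and if `supp μ` is an interval then
`supp μ = [a*, b*]`. -/
theorem joint_sdp_compact_support
    (μ : Measure ℝ) [IsFiniteMeasure μ] (hμ : μ ≠ 0)
    (hcs : IsCompact (msupport μ))
    (hint : ∀ k : ℕ, Integrable (fun x => x ^ k) μ)
    (y : ℕ → ℝ) (hy : ∀ k, y k = ∫ x, x ^ k ∂μ) :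
    (∀ d : ℕ, ∃ p : ℝ × ℝ,
      ((locMat y d p.1).PosSemidef ∧ (negLocMat y d p.2).PosSemidef) ∧
      ∀ q : ℝ × ℝ, (locMat y d q.1).PosSemidef → (negLocMat y d q.2).PosSemidef →
        p.2 - p.1 ≤ q.2 - q.1) ∧
    (∀ ab : ℕ → ℝ × ℝ,
      (∀ d : ℕ, ((locMat y d (ab d).1).PosSemidef ∧ (negLocMat y d (ab d).2).PosSemidef) ∧
        ∀ q : ℝ × ℝ, (locMat y d q.1).PosSemidef → (negLocMat y d q.2).PosSemidef →
          (ab d).2 - (ab d).1 ≤ q.2 - q.1) →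
      Tendsto ab atTop (nhds (sInf (msupport μ), sSup (msupport μ)))) ∧
    msupport μ ⊆ Set.Icc (sInf (msupport μ)) (sSup (msupport μ)) ∧
    (∀ a b : ℝ, msupport μ ⊆ Set.Icc a b →
      a ≤ sInf (msupport μ) ∧ sSup (msupport μ) ≤ b) ∧
    ((msupport μ).OrdConnected →
      msupport μ = Set.Icc (sInf (msupport μ)) (sSup (msupport μ))) := by
  rw [msupport_eq_support] at *
  have hne := Measure.nonempty_support hμ
  have hleast : IsLeast μ.support (sInf μ.support) := hcs.isLeast_sInf hne
  have hgreatest : IsGreatest μ.support (sSup μ.support) := hcs.isGreatest_sSup hne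
  simp only [locMat_posSemidef_iff_s13 hcs hy, negLocMat_posSemidef_iff hcs hy]
  have hsub : μ.support ⊆ Set.Icc (sInf μ.support) (sSup μ.support) :=
    fun x hx => ⟨hleast.2 hx, hgreatest.2 hx⟩
  refine ⟨fun d => ?_, fun ab hab => ?_, hsub,
    fun a b h => ⟨(h hleast.1).1, (h hgreatest.1).2⟩,
    fun hconn => hsub.antisymm (hconn.out hleast.1 hgreatest.1)⟩
  · obtain ⟨a, ha⟩ := exists_isGreatest_sosLowerBounds hcs hμ continuous_id d
    obtain ⟨b, hb⟩ := exists_isGreatest_sosLowerBounds hcs hμ continuous_neg d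
    refine ⟨(a, -b), ⟨ha.1, by simpa using hb.1⟩, fun q hq1 hq2 => ?_⟩
    have h1 := ha.2 hq1
    have h2 := hb.2 hq2
    simp only
    linarith
  · have hfst : ∀ d, IsGreatest (sosLowerBounds μ id d) (ab d).1 := fun d =>
      ⟨(hab d).1.1, fun t ht => by
        have := (hab d).2 (t, (ab d).2) ht (hab d).1.2
        linarith⟩
    have hsnd : ∀ d, IsGreatest (sosLowerBounds μ (fun x => -x) d) (-(ab d).2) := fun d =>
      ⟨(hab d).1.2, fun t ht => by
        have := (hab d).2 ((ab d).1, -t) (hab d).1.1 (by simpa using ht)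
        linarith⟩
    have hmin : IsLeast ((fun x => -x) '' μ.support) (-sSup μ.support) :=
      ⟨⟨_, hgreatest.1, rfl⟩, by
        rintro _ ⟨x, hx, rfl⟩
        exact neg_le_neg (hgreatest.2 hx)⟩
    have hlim1 := tendsto_of_isGreatest_sosLowerBounds hcs continuous_id hfst
      (by simpa using hleast)
    have hlim2 := tendsto_of_isGreatest_sosLowerBounds hcs continuous_neg hsnd hmin
    exact hlim1.prodMk_nhds (by simpa using hlim2.neg)
end

section
/- Let μ be a finite Borel measure on ℝ all of whose moments y_k = ∫ x^k dμ are finite, let d ∈ ℕ, and let a ∈ ℝ be such that H_d(θ_a y) is positive semidefinite. Let σ be a finite sum of squares of real polynomials each of degree at most d, normalized so that ∫ σ dμ = 1. Then a ≤ ∫ x σ(x) dμ(x). -/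
open MeasureTheory Filter

/-- Polynomials are integrable against a measure all of whose moments are finite. -/
theorem Polynomial.integrable_eval_of_integrable_pow {μ : Measure ℝ}
    (hint : ∀ k : ℕ, Integrable (fun x => x ^ k) μ) (q : Polynomial ℝ) :
    Integrable (fun x => q.eval x) μ := by
  simp only [Polynomial.eval_eq_sum_range]
  exact integrable_finsetSum _ fun k _ => (hint k).const_mul _

/-- The quadratic form of the localizing matrix at the coefficients of `q` is
`∫ (x - a) q(x)² dμ(x)`. -/
theorem integral_sub_mul_eval_sq_eq_dotProduct_locMat {μ : Measure ℝ}
    (hint : ∀ k : ℕ, Integrable (fun x => x ^ k) μ)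
    {y : ℕ → ℝ} (hy : ∀ k, y k = ∫ x, x ^ k ∂μ) {d : ℕ} (a : ℝ)
    {q : Polynomial ℝ} (hq : q.natDegree ≤ d) :
    ∫ x, (x - a) * q.eval x ^ 2 ∂μ =
      (fun i : Fin (d + 1) => q.coeff i) ⬝ᵥ
        (locMat y d a).mulVec (fun i : Fin (d + 1) => q.coeff i) := by
  have hexp : ∀ x : ℝ, (x - a) * q.eval x ^ 2 = ∑ i : Fin (d + 1), ∑ j : Fin (d + 1),
      q.coeff i * q.coeff j * (x ^ (i + j + 1 : ℕ) - a * x ^ (i + j : ℕ)) := by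
    intro x
    rw [Polynomial.eval_eq_sum_range' (Nat.lt_succ_of_le hq), ← Fin.sum_univ_eq_sum_range
      (fun i => q.coeff i * x ^ i), sq, Finset.sum_mul_sum, Finset.mul_sum]
    refine Finset.sum_congr rfl fun i _ => ?_
    rw [Finset.mul_sum]
    exact Finset.sum_congr rfl fun j _ => by ring
  have hterm : ∀ i j : Fin (d + 1), Integrable (fun x : ℝ =>
      q.coeff i * q.coeff j * (x ^ (i + j + 1 : ℕ) - a * x ^ (i + j : ℕ))) μ := fun i j =>
    ((hint _).sub ((hint _).const_mul a)).const_mul _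
  simp only [hexp, dotProduct, Matrix.mulVec]
  rw [integral_finsetSum _ fun i _ => integrable_finsetSum _ fun j _ => hterm i j]
  refine Finset.sum_congr rfl fun i _ => ?_
  rw [integral_finsetSum _ fun j _ => hterm i j, Finset.mul_sum]
  refine Finset.sum_congr rfl fun j _ => ?_
  rw [integral_const_mul, integral_sub (hint _) ((hint _).const_mul a), integral_const_mul,
    ← hy, ← hy, locMat, Matrix.of_apply]
  ring

/-- weak duality: if `H_d(θ_a y) ⪰ 0` and `σ = Σ_ℓ p_ℓ²` is a sum of squares of
polynomials of degree at most `d` with `∫ σ dμ = 1`, then `a ≤ ∫ x σ(x) dμ(x)`. -/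
theorem weak_duality_a
    (μ : Measure ℝ) [IsFiniteMeasure μ]
    (hint : ∀ k : ℕ, Integrable (fun x => x ^ k) μ)
    (y : ℕ → ℝ) (hy : ∀ k, y k = ∫ x, x ^ k ∂μ)
    (d : ℕ) (a : ℝ) (ha : (locMat y d a).PosSemidef)
    (m : ℕ) (p : Fin m → Polynomial ℝ) (hdeg : ∀ ℓ, (p ℓ).natDegree ≤ d)
    (hnorm : (∫ x, (∑ ℓ, (p ℓ).eval x ^ 2) ∂μ) = 1) :
    a ≤ ∫ x, x * (∑ ℓ, (p ℓ).eval x ^ 2) ∂μ := by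
  set s : Polynomial ℝ := ∑ ℓ, p ℓ ^ 2 with hs
  have hsum : ∀ x : ℝ, ∑ ℓ, (p ℓ).eval x ^ 2 = s.eval x := fun x => by
    simp [hs, Polynomial.eval_finsetSum]
  have hpoly := Polynomial.integrable_eval_of_integrable_pow hint
  have hnonneg : 0 ≤ ∫ x, (x - a) * (∑ ℓ, (p ℓ).eval x ^ 2) ∂μ := by
    simp only [Finset.mul_sum]
    rw [integral_finsetSum _ fun ℓ _ =>
      (hpoly ((Polynomial.X - Polynomial.C a) * p ℓ ^ 2)).congr <|
        .of_forall fun x => by simp]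
    refine Finset.sum_nonneg fun ℓ _ => ?_
    rw [integral_sub_mul_eval_sq_eq_dotProduct_locMat hint hy a (hdeg ℓ)]
    simpa using ha.dotProduct_mulVec_nonneg fun i : Fin (d + 1) => (p ℓ).coeff i
  have hxs : Integrable (fun x => x * s.eval x) μ :=
    (hpoly (Polynomial.X * s)).congr <| .of_forall fun x => by simp
  simp only [hsum, sub_mul] at hnonneg hnorm ⊢
  rw [integral_sub hxs ((hpoly s).const_mul a), integral_const_mul, hnorm] at hnonneg
  linarith
end

section
/- Let μ be a finite nonzero Borel measure on ℝ all of whose moments y_k = ∫ x^k dμ are finite, and suppose the moment matrix H_d(y) (entries y_{i+j}) is positive definite for every d ∈ ℕ. Fix d ∈ ℕ and let a_d := max{ a : H_d(θ_a y) ⪰ 0 } and b_d := min{ b : H_d(−θ_b y) ⪰ 0 }. Then a_d = min{ ∫ x σ(x) dμ(x) : σ a sum of squares of polynomials of degree ≤ d with ∫ σ dμ = 1 } and b_d = max{ ∫ x σ(x) dμ(x) : σ a sum of squares of polynomials of degree ≤ d with ∫ σ dμ = 1 }; both extrema are attained, say at σ* and ψ*, and ∫ (x − a_d) σ*(x) dμ(x)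 = 0 = ∫ (b_d − x) ψ*(x) dμ(x). -/
open MeasureTheory Filter

/-- The Hankel moment matrix `H_d(y)` with entries `y_{i+j}`. -/
noncomputable def momMat (y : ℕ → ℝ) (d : ℕ) :
    Matrix (Fin (d + 1)) (Fin (d + 1)) ℝ :=
  Matrix.of fun i j : Fin (d + 1) => y (i + j : ℕ)

open scoped Matrix

/-- A generalized Rayleigh quotient with positive definite denominator attains its minimum. -/
theorem exists_min_generalized_rayleigh {n : Type*} [Fintype n] [Nonempty n]
    (A : Matrix n n ℝ) {B : Matrix n n ℝ} (hB : B.PosDef) :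
    ∃ v : n → ℝ, v ⬝ᵥ B *ᵥ v = 1 ∧
      ∀ w : n → ℝ, (v ⬝ᵥ A *ᵥ v) * (w ⬝ᵥ B *ᵥ w) ≤ w ⬝ᵥ A *ᵥ w := by
  have hpos : ∀ w : n → ℝ, w ≠ 0 → 0 < w ⬝ᵥ B *ᵥ w := fun w hw => by
    simpa using hB.dotProduct_mulVec_pos hw
  have hscale : ∀ (M : Matrix n n ℝ) (t : ℝ) (w : n → ℝ),
      (t • w) ⬝ᵥ M *ᵥ (t • w) = t ^ 2 * (w ⬝ᵥ M *ᵥ w) := fun M t w => by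
    simp only [Matrix.mulVec_smul, smul_dotProduct, dotProduct_smul, smul_eq_mul]; ring
  have hcont : ∀ M : Matrix n n ℝ, Continuous fun w : n → ℝ => w ⬝ᵥ M *ᵥ w := fun M => by
    fun_prop
  have hne : ∀ u ∈ Metric.sphere (0 : n → ℝ) 1, u ≠ 0 := fun u hu =>
    Metric.ne_of_mem_sphere hu one_ne_zero
  obtain ⟨u, hu, hmin⟩ := (isCompact_sphere (0 : n → ℝ) 1).exists_isMinOn
    (NormedSpace.sphere_nonempty.mpr zero_le_one)
    (f := fun w => (w ⬝ᵥ A *ᵥ w) / (w ⬝ᵥ B *ᵥ w))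
    ((hcont A).continuousOn.div (hcont B).continuousOn fun w hw => (hpos w (hne w hw)).ne')
  have hu0 := hpos u (hne u hu)
  have hsq : (√(u ⬝ᵥ B *ᵥ u))⁻¹ ^ 2 = (u ⬝ᵥ B *ᵥ u)⁻¹ := by
    rw [inv_pow, Real.sq_sqrt hu0.le]
  refine ⟨(√(u ⬝ᵥ B *ᵥ u))⁻¹ • u, ?_, fun w => ?_⟩
  · rw [hscale, hsq, inv_mul_cancel₀ hu0.ne']
  · rw [hscale, hsq, inv_mul_eq_div]
    rcases eq_or_ne w 0 with rfl | hw
    · simp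
    have hn : ‖w‖ ≠ 0 := norm_ne_zero_iff.mpr hw
    have hmem : ‖w‖⁻¹ • w ∈ Metric.sphere (0 : n → ℝ) 1 := by
      simp [norm_smul, hn]
    have h := isMinOn_iff.mp hmin _ hmem
    simp only [hscale] at h
    rwa [mul_div_mul_left _ _ (by positivity), le_div_iff₀ (hpos w hw)] at h

/-- The values of `a` for which `A - a B` is positive semidefinite have as greatest element the
value of `A` at a minimizer of the generalized Rayleigh quotient. -/
theorem isGreatest_posSemidef_sub_smul {n : Type*} [Fintype n] {A B : Matrix n n ℝ}
    (hA : A.IsHermitian) (hB : B.IsHermitian) {v : n → ℝ} (hv : v ⬝ᵥ B *ᵥ v = 1)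
    (hmin : ∀ w : n → ℝ, (v ⬝ᵥ A *ᵥ v) * (w ⬝ᵥ B *ᵥ w) ≤ w ⬝ᵥ A *ᵥ w) :
    IsGreatest {a : ℝ | (A - a • B).PosSemidef} (v ⬝ᵥ A *ᵥ v) := by
  have hquad : ∀ (a : ℝ) (w : n → ℝ),
      w ⬝ᵥ (A - a • B) *ᵥ w = w ⬝ᵥ A *ᵥ w - a * (w ⬝ᵥ B *ᵥ w) := fun a w => by
    rw [Matrix.sub_mulVec, dotProduct_sub, Matrix.smul_mulVec, dotProduct_smul, smul_eq_mul]
  refine ⟨.of_dotProduct_mulVec_nonneg (hA.sub (hB.smul (.all _))) fun w => ?_,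
    fun a ha => ?_⟩
  · rw [star_trivial, hquad]
    exact sub_nonneg.mpr (hmin w)
  · have h := Matrix.PosSemidef.dotProduct_mulVec_nonneg ha v
    rw [star_trivial, hquad, hv, mul_one] at h
    exact sub_nonneg.mp h

/-- The shifted Hankel matrix with entries `y_{i+j+k}`. -/
def shiftedHankel (y : ℕ → ℝ) (d k : ℕ) : Matrix (Fin (d + 1)) (Fin (d + 1)) ℝ :=
  Matrix.of fun i j : Fin (d + 1) => y (i + j + k : ℕ)

theorem shiftedHankel_zero (y : ℕ → ℝ) (d : ℕ) : shiftedHankel y d 0 = momMat y d := rfl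

theorem isHermitian_shiftedHankel (y : ℕ → ℝ) (d k : ℕ) : (shiftedHankel y d k).IsHermitian := by
  ext i j
  simp [shiftedHankel, add_comm]

theorem negLocMat_eq_sub_smul (y : ℕ → ℝ) (d : ℕ) (b : ℝ) :
    negLocMat y d b = -shiftedHankel y d 1 - (-b) • momMat y d := by
  ext i j
  simp [negLocMat, shiftedHankel, momMat]
  ring

theorem dotProduct_shiftedHankel_mulVec (y : ℕ → ℝ) (d k : ℕ) (c : Fin (d + 1) → ℝ) :
    c ⬝ᵥ shiftedHankel y d k *ᵥ c = ∑ i, ∑ j, c i * c j * y (i + j + k : ℕ) := by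
  simp only [dotProduct, Matrix.mulVec, shiftedHankel, Matrix.of_apply, Finset.mul_sum]
  exact Finset.sum_congr rfl fun i _ => Finset.sum_congr rfl fun j _ => by ring

theorem pow_mul_eval_sq {d : ℕ} {p : Polynomial ℝ} (hp : p.natDegree ≤ d) (k : ℕ) (x : ℝ) :
    x ^ k * p.eval x ^ 2 = ∑ i : Fin (d + 1), ∑ j : Fin (d + 1),
      p.coeff i * p.coeff j * x ^ (i + j + k : ℕ) := by
  rw [Polynomial.eval_eq_sum_range' (Nat.lt_succ_of_le hp),
    ← Fin.sum_univ_eq_sum_range (fun i => p.coeff i * x ^ i), sq, Finset.sum_mul_sum,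
    Finset.mul_sum]
  refine Finset.sum_congr rfl fun i _ => ?_
  rw [Finset.mul_sum]
  exact Finset.sum_congr rfl fun j _ => by ring

theorem integrable_pow_mul_eval_sq {μ : Measure ℝ}
    (hint : ∀ k : ℕ, Integrable (fun x => x ^ k) μ) (k : ℕ) (p : Polynomial ℝ) :
    Integrable (fun x => x ^ k * p.eval x ^ 2) μ := by
  simp only [pow_mul_eval_sq le_rfl]
  exact integrable_finsetSum _ fun i _ => integrable_finsetSum _ fun j _ =>
    (hint _).const_mul _

theorem integrable_pow_mul_sum_eval_sq {μ : Measure ℝ}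
    (hint : ∀ k : ℕ, Integrable (fun x => x ^ k) μ) (k : ℕ) {m : ℕ}
    (p : Fin m → Polynomial ℝ) :
    Integrable (fun x => x ^ k * ∑ ℓ, (p ℓ).eval x ^ 2) μ := by
  simp only [Finset.mul_sum]
  exact integrable_finsetSum _ fun ℓ _ => integrable_pow_mul_eval_sq hint k _

theorem integral_pow_mul_sum_eval_sq {μ : Measure ℝ}
    (hint : ∀ k : ℕ, Integrable (fun x => x ^ k) μ)
    {y : ℕ → ℝ} (hy : ∀ k, y k = ∫ x, x ^ k ∂μ) {d : ℕ} (k : ℕ) {m : ℕ}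
    {p : Fin m → Polynomial ℝ} (hp : ∀ ℓ, (p ℓ).natDegree ≤ d) :
    ∫ x, x ^ k * ∑ ℓ, (p ℓ).eval x ^ 2 ∂μ =
      ∑ ℓ, (fun i : Fin (d + 1) => (p ℓ).coeff i) ⬝ᵥ
        shiftedHankel y d k *ᵥ (fun i : Fin (d + 1) => (p ℓ).coeff i) := by
  simp only [Finset.mul_sum]
  rw [integral_finsetSum _ fun ℓ _ => integrable_pow_mul_eval_sq hint k _]
  refine Finset.sum_congr rfl fun ℓ _ => ?_
  simp only [pow_mul_eval_sq (hp ℓ), dotProduct_shiftedHankel_mulVec]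
  rw [integral_finsetSum _ fun i _ => integrable_finsetSum _ fun j _ => (hint _).const_mul _]
  refine Finset.sum_congr rfl fun i _ => ?_
  rw [integral_finsetSum _ fun j _ => (hint _).const_mul _]
  exact Finset.sum_congr rfl fun j _ => by rw [integral_const_mul, hy]

/-- Every coefficient vector of length `d + 1` comes from a polynomial of degree at most `d`. -/
theorem exists_natDegree_le_coeff_eq {R : Type*} [Semiring R] {d : ℕ} (v : Fin (d + 1) → R) :
    ∃ p : Polynomial R, p.natDegree ≤ d ∧ (fun i : Fin (d + 1) => p.coeff i) = v := by
  refine ⟨∑ i : Fin (d + 1), Polynomial.monomial i (v i),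
    Polynomial.natDegree_sum_le_of_forall_le _ _ fun i _ =>
      (Polynomial.natDegree_monomial_le _).trans (Nat.lt_succ_iff.mp i.2), ?_⟩
  ext i
  simp [Polynomial.finsetSum_coeff, Polynomial.coeff_monomial, Fin.val_inj]

/-- strong duality: if all moment matrices `H_d(y)` are positive definite, then
`a_d = max {a : H_d(θ_a y) ⪰ 0}` equals the minimum of `∫ x σ dμ` over sums of squares `σ` of
polynomials of degree at most `d` with `∫ σ dμ = 1`, and dually for `b_d`; both dual extrema
are attained, at `σ*` and `ψ*` say, and
`∫ (x - a_d) σ* dμ = 0 = ∫ (b_d - x) ψ* dμ`. -/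
theorem strong_duality
    (μ : Measure ℝ) [IsFiniteMeasure μ] (hμ : μ ≠ 0)
    (hint : ∀ k : ℕ, Integrable (fun x => x ^ k) μ)
    (y : ℕ → ℝ) (hy : ∀ k, y k = ∫ x, x ^ k ∂μ)
    (hPD : ∀ d : ℕ, (momMat y d).PosDef) (d : ℕ) :
    sSup {a : ℝ | (locMat y d a).PosSemidef} =
      sInf {r : ℝ | ∃ (m : ℕ) (p : Fin m → Polynomial ℝ),
        (∀ ℓ, (p ℓ).natDegree ≤ d) ∧ (∫ x, (∑ ℓ, (p ℓ).eval x ^ 2) ∂μ) = 1 ∧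
        r = ∫ x, x * (∑ ℓ, (p ℓ).eval x ^ 2) ∂μ} ∧
    sInf {b : ℝ | (negLocMat y d b).PosSemidef} =
      sSup {r : ℝ | ∃ (m : ℕ) (p : Fin m → Polynomial ℝ),
        (∀ ℓ, (p ℓ).natDegree ≤ d) ∧ (∫ x, (∑ ℓ, (p ℓ).eval x ^ 2) ∂μ) = 1 ∧
        r = ∫ x, x * (∑ ℓ, (p ℓ).eval x ^ 2) ∂μ} ∧
    (∃ (m : ℕ) (p : Fin m → Polynomial ℝ),
      (∀ ℓ, (p ℓ).natDegree ≤ d) ∧ (∫ x, (∑ ℓ, (p ℓ).eval x ^ 2) ∂μ) = 1 ∧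
      (∫ x, x * (∑ ℓ, (p ℓ).eval x ^ 2) ∂μ) =
        sSup {a : ℝ | (locMat y d a).PosSemidef} ∧
      (∫ x, (x - sSup {a : ℝ | (locMat y d a).PosSemidef}) *
        (∑ ℓ, (p ℓ).eval x ^ 2) ∂μ) = 0) ∧
    (∃ (m : ℕ) (q : Fin m → Polynomial ℝ),
      (∀ ℓ, (q ℓ).natDegree ≤ d) ∧ (∫ x, (∑ ℓ, (q ℓ).eval x ^ 2) ∂μ) = 1 ∧
      (∫ x, x * (∑ ℓ, (q ℓ).eval x ^ 2) ∂μ) =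
        sInf {b : ℝ | (negLocMat y d b).PosSemidef} ∧
      (∫ x, (sInf {b : ℝ | (negLocMat y d b).PosSemidef} - x) *
        (∑ ℓ, (q ℓ).eval x ^ 2) ∂μ) = 0) := by
  have hH := isHermitian_shiftedHankel y d 1
  have hB := hPD d
  have hmom : ∀ {m : ℕ} {p : Fin m → Polynomial ℝ}, (∀ ℓ, (p ℓ).natDegree ≤ d) →
      ∫ x, (∑ ℓ, (p ℓ).eval x ^ 2) ∂μ = ∑ ℓ, (fun i : Fin (d + 1) => (p ℓ).coeff i) ⬝ᵥ
        momMat y d *ᵥ (fun i : Fin (d + 1) => (p ℓ).coeff i) := fun hp => by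
    simpa [shiftedHankel_zero] using integral_pow_mul_sum_eval_sq hint hy 0 hp
  have hloc : ∀ {m : ℕ} {p : Fin m → Polynomial ℝ}, (∀ ℓ, (p ℓ).natDegree ≤ d) →
      ∫ x, x * (∑ ℓ, (p ℓ).eval x ^ 2) ∂μ = ∑ ℓ, (fun i : Fin (d + 1) => (p ℓ).coeff i) ⬝ᵥ
        shiftedHankel y d 1 *ᵥ (fun i : Fin (d + 1) => (p ℓ).coeff i) := fun hp => by
    simpa using integral_pow_mul_sum_eval_sq hint hy 1 hp
  have hattain : ∀ v : Fin (d + 1) → ℝ, v ⬝ᵥ momMat y d *ᵥ v = 1 →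
      ∃ (m : ℕ) (p : Fin m → Polynomial ℝ), (∀ ℓ, (p ℓ).natDegree ≤ d) ∧
        (∫ x, (∑ ℓ, (p ℓ).eval x ^ 2) ∂μ) = 1 ∧
        (∫ x, x * (∑ ℓ, (p ℓ).eval x ^ 2) ∂μ) = v ⬝ᵥ shiftedHankel y d 1 *ᵥ v := fun v hv => by
    obtain ⟨p, hp, rfl⟩ := exists_natDegree_le_coeff_eq v
    refine ⟨1, fun _ => p, fun _ => hp, ?_, ?_⟩
    · rw [hmom fun _ => hp]
      simpa using hv
    · rw [hloc fun _ => hp]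
      simp
  have hcompl : ∀ {m : ℕ} (p : Fin m → Polynomial ℝ) {r : ℝ},
      (∫ x, (∑ ℓ, (p ℓ).eval x ^ 2) ∂μ) = 1 → (∫ x, x * (∑ ℓ, (p ℓ).eval x ^ 2) ∂μ) = r →
      ∫ x, (x - r) * (∑ ℓ, (p ℓ).eval x ^ 2) ∂μ = 0 := fun p r h1 hr => by
    have hi0 := integrable_pow_mul_sum_eval_sq hint 0 p
    have hi1 := integrable_pow_mul_sum_eval_sq hint 1 p
    simp only [pow_zero, one_mul, pow_one] at hi0 hi1
    simp only [sub_mul]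
    rw [integral_sub hi1 (hi0.const_mul r), integral_const_mul, h1, hr, mul_one, sub_self]
  obtain ⟨v, hv, hvmin⟩ := exists_min_generalized_rayleigh (shiftedHankel y d 1) hB
  obtain ⟨u, hu, humin⟩ := exists_min_generalized_rayleigh (-shiftedHankel y d 1) hB
  have ha : sSup {a : ℝ | (locMat y d a).PosSemidef} = v ⬝ᵥ shiftedHankel y d 1 *ᵥ v :=
    (isGreatest_posSemidef_sub_smul hH hB.1 hv hvmin).csSup_eq
  have hb : sInf {b : ℝ | (negLocMat y d b).PosSemidef} = u ⬝ᵥ shiftedHankel y d 1 *ᵥ u := by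
    have h := isGreatest_posSemidef_sub_smul hH.neg hB.1 hu humin
    simp only [Matrix.neg_mulVec, dotProduct_neg] at h
    refine IsLeast.csInf_eq ⟨?_, fun b hb => ?_⟩
    · rw [Set.mem_ofPred_eq, negLocMat_eq_sub_smul]
      exact h.1
    · rw [Set.mem_ofPred_eq, negLocMat_eq_sub_smul] at hb
      exact neg_le_neg_iff.mp (h.2 hb)
  obtain ⟨m, p, hp, hp1, hpv⟩ := hattain v hv
  obtain ⟨n, q, hq, hq1, hqu⟩ := hattain u hu
  rw [ha, hb]
  refine ⟨Eq.symm (IsLeast.csInf_eq ⟨?_, ?_⟩), Eq.symm (IsGreatest.csSup_eq ⟨?_, ?_⟩),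
    ⟨m, p, hp, hp1, hpv, hcompl p hp1 hpv⟩, ⟨n, q, hq, hq1, hqu, ?_⟩⟩
  · exact ⟨m, p, hp, hp1, hpv.symm⟩
  · rintro r ⟨k, s, hs, hs1, rfl⟩
    rw [hmom hs] at hs1
    rw [hloc hs, ← mul_one (v ⬝ᵥ _), ← hs1, Finset.mul_sum]
    exact Finset.sum_le_sum fun ℓ _ => hvmin _
  · exact ⟨n, q, hq, hq1, hqu.symm⟩
  · rintro r ⟨k, s, hs, hs1, rfl⟩
    rw [hmom hs] at hs1
    rw [hloc hs, ← mul_one (u ⬝ᵥ _), ← hs1, Finset.mul_sum]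
    refine Finset.sum_le_sum fun ℓ _ => ?_
    simpa [Matrix.neg_mulVec] using humin fun i : Fin (d + 1) => (s ℓ).coeff i
  · rw [← neg_eq_zero, ← integral_neg]
    simpa only [← neg_mul, neg_sub] using hcompl q hq1 hqu
end
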